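/- Let $\rho,\beta,\varepsilon,h,\gamma,\lambda_0>0$ be real numbers, let $N\ge 2$ be an integer, and set $a=8\frac{N}{N-1}\beta\rho^2$. For $\alpha\ge 1$ define $$\lambda_*(\alpha)=\min\Big\{e^{-ah}\lambda_0,\ \frac{\gamma^2}{\alpha^2}\big(e^{-ah}\alpha^2-1\big)\Big\},\qquad \theta(\alpha)=\Big(1+\frac{\alpha^2}{\gamma^2}\lambda_*(\alpha)\Big)^{-2}e^{2(\beta+\varepsilon)h},$$ and let $$\alpha_0=\max\Big\{\lambda_0^{-1/2}\,\gamma\, e^{ah}\big(e^{(\beta+\varepsilon)h}-1\big)^{1/2},\ e^{(a+\beta+\varepsilon)h/2}\Big\}\ (>1).$$ If $\alpha\ge\alpha_0$, then $e^{-ah}\alpha^2>1$ and $\theta(\alpha)\le 1$, with $\theta(\alpha)=1$ if and only if $\alpha=e^{(a+\beta+\varepsilon)h/2}$. In particular, $\theta(\alpha)<1$ for every $\alpha>\alpha_0$. -/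

import Mathlib

noncomputable section

namespace ETKF

/-- The rate `a = 8 (N / (N - 1)) β ρ²`. -/
def rate (ρ β : ℝ) (N : ℕ) : ℝ :=
  8 * ((N : ℝ) / ((N : ℝ) - 1)) * β * ρ ^ 2

/-- `λ_*(α) = min {e^{-ah} λ₀, (γ² / α²) (e^{-ah} α² - 1)}`. -/
def lamStar (a h γ lam0 α : ℝ) : ℝ :=
  min (Real.exp (-(a * h)) * lam0)
    (γ ^ 2 / α ^ 2 * (Real.exp (-(a * h)) * α ^ 2 - 1))

/-- `θ(α) = (1 + (α² / γ²) λ_*(α))^{-2} e^{2(β + ε)h}`. -/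
def theta (a β ε h γ lam0 α : ℝ) : ℝ :=
  (1 + α ^ 2 / γ ^ 2 * lamStar a h γ lam0 α) ^ (-2 : ℤ) * Real.exp (2 * (β + ε) * h)

/-- `α₀ = max {λ₀^{-1/2} γ e^{ah} (e^{(β + ε)h} - 1)^{1/2}, e^{(a + β + ε)h/2}}`. -/
def alpha0 (a β ε h γ lam0 : ℝ) : ℝ :=
  max (lam0 ^ (-(1 / 2) : ℝ) * γ * Real.exp (a * h) *
      (Real.exp ((β + ε) * h) - 1) ^ ((1 / 2) : ℝ))
    (Real.exp ((a + β + ε) * h / 2))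

end ETKF

end

namespace ETKF

theorem rate_pos {ρ β : ℝ} {N : ℕ} (hρ : 0 < ρ) (hβ : 0 < β) (hN : 2 ≤ N) : 0 < rate ρ β N := by
  have h2 : (2 : ℝ) ≤ N := by exact_mod_cast hN
  have h1 : (0 : ℝ) < N - 1 := by linarith
  have h0 : (0 : ℝ) < N := by linarith
  unfold rate
  positivity

theorem gain_eq_min {a h γ lam0 α : ℝ} (hγ : 0 < γ) (hα : 0 < α) :
    1 + α ^ 2 / γ ^ 2 * lamStar a h γ lam0 α =
      min (1 + α ^ 2 / γ ^ 2 * (Real.exp (-(a * h)) * lam0)) (Real.exp (-(a * h)) * α ^ 2) := by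
  have hc : 0 ≤ α ^ 2 / γ ^ 2 := by positivity
  rw [lamStar, mul_min_of_nonneg _ _ hc, ← min_add_add_left]
  congr 1
  field_simp
  ring

theorem theta_eq_sq (a β ε h γ lam0 α : ℝ) :
    theta a β ε h γ lam0 α =
      (Real.exp ((β + ε) * h) / (1 + α ^ 2 / γ ^ 2 * lamStar a h γ lam0 α)) ^ 2 := by
  have hE : Real.exp (2 * (β + ε) * h) = Real.exp ((β + ε) * h) ^ 2 := by
    rw [← Real.exp_nat_mul]
    congr 1
    push_cast
    ring
  rw [theta, hE, div_pow, zpow_neg, div_eq_inv_mul (Real.exp _ ^ 2)]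
  norm_cast

theorem exp_lt_first_gain {a β ε h γ lam0 α : ℝ} (hah : 0 < a * h) (hβε : 0 < (β + ε) * h)
    (hγ : 0 < γ) (hlam0 : 0 < lam0)
    (hα : lam0 ^ (-(1 / 2) : ℝ) * γ * Real.exp (a * h) *
      (Real.exp ((β + ε) * h) - 1) ^ ((1 / 2) : ℝ) ≤ α) :
    Real.exp ((β + ε) * h) < 1 + α ^ 2 / γ ^ 2 * (Real.exp (-(a * h)) * lam0) := by
  have hD : 1 < Real.exp (a * h) := Real.one_lt_exp_iff.2 hah
  have hE : 0 < Real.exp ((β + ε) * h) - 1 := sub_pos.2 (Real.one_lt_exp_iff.2 hβε)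
  rw [Real.exp_neg]
  set D := Real.exp (a * h)
  set E := Real.exp ((β + ε) * h)
  have hsq : γ ^ 2 * D ^ 2 * (E - 1) / lam0 ≤ α ^ 2 := by
    refine le_trans (le_of_eq ?_) (pow_le_pow_left₀ (by positivity) hα 2)
    rw [Real.rpow_neg hlam0.le, ← Real.sqrt_eq_rpow, ← Real.sqrt_eq_rpow]
    simp only [mul_pow, inv_pow, Real.sq_sqrt hlam0.le, Real.sq_sqrt hE.le]
    field_simp
  have hgain : D * (E - 1) ≤ α ^ 2 / γ ^ 2 * (D⁻¹ * lam0) := by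
    calc D * (E - 1) = γ ^ 2 * D ^ 2 * (E - 1) / lam0 / γ ^ 2 * (D⁻¹ * lam0) := by field_simp
      _ ≤ _ := by gcongr
  nlinarith [mul_pos (sub_pos.2 hD) hE]

end ETKF

open ETKF in
theorem stmt17 (ρ β ε h γ lam0 : ℝ) (N : ℕ)
    (hρ : 0 < ρ) (hβ : 0 < β) (hε : 0 < ε) (hh : 0 < h) (hγ : 0 < γ) (hlam0 : 0 < lam0)
    (hN : 2 ≤ N) (a : ℝ) (ha : a = ETKF.rate ρ β N)
    (α : ℝ) (hα : ETKF.alpha0 a β ε h γ lam0 ≤ α) :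
    1 < Real.exp (-(a * h)) * α ^ 2 ∧
    (ETKF.alpha0 a β ε h γ lam0 < α → ETKF.theta a β ε h γ lam0 α < 1) ∧
    ETKF.theta a β ε h γ lam0 α ≤ 1 ∧
    (ETKF.theta a β ε h γ lam0 α = 1 ↔ α = Real.exp ((a + β + ε) * h / 2)) := by
  have ha0 : 0 < a := ha ▸ rate_pos hρ hβ hN
  have hβε : 0 < (β + ε) * h := by positivity
  have hα₁ := (le_max_left _ _).trans hα
  have hα₂ : Real.exp ((a + β + ε) * h / 2) ≤ α := (le_max_right _ _).trans hα
  have hα0 : 0 < α := (Real.exp_pos _).trans_le hα₂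
  have hfirst := exp_lt_first_gain (by positivity) hβε hγ hlam0 hα₁
  have hexp : Real.exp (-(a * h)) * Real.exp ((a + β + ε) * h / 2) ^ 2 =
      Real.exp ((β + ε) * h) := by
    rw [← Real.exp_nat_mul, ← Real.exp_add]
    congr 1
    push_cast
    ring
  have hsecond : Real.exp ((β + ε) * h) ≤ Real.exp (-(a * h)) * α ^ 2 := by
    rw [← hexp]
    gcongr
  have hgain : Real.exp ((β + ε) * h) ≤ 1 + α ^ 2 / γ ^ 2 * lamStar a h γ lam0 α := by
    rw [gain_eq_min hγ hα0]
    exact le_min hfirst.le hsecond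
  have hpos := (Real.exp_pos ((β + ε) * h)).trans_le hgain
  have hle : theta a β ε h γ lam0 α ≤ 1 := by
    rw [theta_eq_sq]
    exact pow_le_one₀ (by positivity) ((div_le_one hpos).2 hgain)
  have hiff : theta a β ε h γ lam0 α = 1 ↔ α = Real.exp ((a + β + ε) * h / 2) := by
    rw [theta_eq_sq, pow_eq_one_iff_of_nonneg (by positivity) two_ne_zero,
      div_eq_one_iff_eq hpos.ne', gain_eq_min hγ hα0]
    constructor
    · intro heq
      rcases min_choice (1 + α ^ 2 / γ ^ 2 * (Real.exp (-(a * h)) * lam0))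
        (Real.exp (-(a * h)) * α ^ 2) with hm | hm
      · exact absurd (heq.trans hm) hfirst.ne
      · have hsq := hexp.trans (heq.trans hm)
        exact ((pow_left_inj₀ (Real.exp_pos _).le hα0.le two_ne_zero).1
          (mul_left_cancel₀ (Real.exp_pos _).ne' hsq)).symm
    · intro heq
      have hα_sq : Real.exp (-(a * h)) * α ^ 2 = Real.exp ((β + ε) * h) := by rw [heq, hexp]
      rw [hα_sq, min_eq_right hfirst.le]
  refine ⟨(Real.one_lt_exp_iff.2 hβε).trans_le hsecond, fun hlt => ?_, hle, hiff⟩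
  exact hle.lt_of_ne fun heq => ((le_max_right _ _).trans_lt hlt).ne' (hiff.1 heq)
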